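/- Let ℓ ≥ 2. The derivations θ_E, φ_1, …, φ_ℓ form a basis of D(cS(D_ℓ)) as an S-module; that is, every θ ∈ D(cS(D_ℓ)) is uniquely an S-linear combination of θ_E, φ_1, …, φ_ℓ, and these ℓ+1 derivations are S-linearly independent. -/

import Mathlib

open MvPolynomial Finset

noncomputable section

/-- Elementary symmetric function of degree `n` of the values of `f` on the finite set `s`. -/
def esymVal {α R : Type*} [CommSemiring R] (s : Finset α) (f : α → R) (n : ℕ) : R :=
  ∑ t ∈ Finset.powersetCard n s, ∏ a ∈ t, f a

/-- The characterizing conditions for the family of Bernoulli-like polynomials `B p q`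
(for `p ≥ -1`, `q ≥ 0`, `(p,q) ≠ (-1,0)`):  oddness and the (denominator-cleared)
difference equations. -/
def BProp (B : ℤ → ℕ → Polynomial ℝ) : Prop :=
  (∀ (p : ℤ) (q : ℕ), -1 ≤ p → ¬(p = -1 ∧ q = 0) →
      (B p q).comp (-Polynomial.X) = -(B p q)) ∧
  (∀ (p q : ℕ),
      (2 * Polynomial.X + 1) * ((B p q).comp (Polynomial.X + 1) - B p q)
        = ((Polynomial.X + 1) ^ p - (-Polynomial.X) ^ p)
            * (Polynomial.X + 1) ^ q * (-Polynomial.X) ^ q) ∧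
  (∀ q : ℕ, 1 ≤ q →
      (B (-1) q).comp (Polynomial.X + 1) - B (-1) q
        = -((-Polynomial.X) * (Polynomial.X + 1)) ^ (q - 1))

/-- The polynomial ring `S = ℝ[x_1, …, x_ℓ, z]`; the variable indexed by
`Fin.castSucc i` is `x_{i+1}` and the variable indexed by `Fin.last ℓ` is `z`. -/
abbrev SS (ℓ : ℕ) := MvPolynomial (Fin (ℓ + 1)) ℝ

/-- The field of rational functions, in which the defining formulas for the `φ_j` live. -/
abbrev KK (ℓ : ℕ) := FractionRing (SS ℓ)

/-- `x_{i+1}` as a rational function. -/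
def xx (ℓ : ℕ) (i : Fin ℓ) : KK ℓ := algebraMap (SS ℓ) (KK ℓ) (X i.castSucc)

/-- `z` as a rational function. -/
def zz (ℓ : ℕ) : KK ℓ := algebraMap (SS ℓ) (KK ℓ) (X (Fin.last ℓ))

/-- `ar B_{p,q}(x, z) = z^{p+2q}·B_{p,q}(x/z)`, as a rational function; by convention
`ar B_{-1,0}(x,z) = -1/x`. -/
def arB (B : ℤ → ℕ → Polynomial ℝ) (ℓ : ℕ) (p : ℤ) (q : ℕ) (x : KK ℓ) : KK ℓ :=
  if p = -1 ∧ q = 0 then -x⁻¹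
  else zz ℓ ^ (p + 2 * (q : ℤ)) *
    Polynomial.eval₂ ((algebraMap (SS ℓ) (KK ℓ)).comp (MvPolynomial.C)) (x / zz ℓ) (B p q)

/-- `J = {x_1, …, x_{j-1}}` (as a set of indices). -/
def Jset (ℓ : ℕ) (j : Fin ℓ) : Finset (Fin ℓ) := univ.filter (· < j)

/-- The value `φ_j(x_i)` (an element of the fraction field, which is in fact
a polynomial).  Here `j` with `(j:ℕ)+1 < ℓ` encodes `φ_{j+1}`, `1 ≤ j+1 ≤ ℓ-1`,
and `j = Fin.last` encodes `φ_ℓ`. -/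
def phi (B : ℤ → ℕ → Polynomial ℝ) (ℓ : ℕ) (j i : Fin ℓ) : KK ℓ :=
  if h : (j : ℕ) + 1 < ℓ then
    (xx ℓ j - xx ℓ ⟨(j : ℕ) + 1, h⟩ - zz ℓ) *
      ∑ K1 ∈ (Jset ℓ j).powerset, ∑ K2 ∈ ((Jset ℓ j) \ K1).powerset,
        (∏ a ∈ K1, xx ℓ a) * (∏ a ∈ K2, xx ℓ a) ^ 2 * (-zz ℓ) ^ K1.card *
          ∑ n1 ∈ Finset.range 3, ∑ n2 ∈ Finset.range (ℓ - (j : ℕ) - 1),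
            (-1 : KK ℓ) ^ (n1 + n2) *
              esymVal ({j, ⟨(j : ℕ) + 1, h⟩} : Finset (Fin ℓ)) (xx ℓ) n1 *
              esymVal (univ.filter (fun a : Fin ℓ => (j : ℕ) + 1 < (a : ℕ)))
                (fun a => xx ℓ a ^ 2) n2 *
              arB B ℓ ((2 - (n1 : ℤ)) + 2 * ((ℓ : ℤ) - (j : ℤ) - 2 - (n2 : ℤ)) - 1)
                ((j : ℕ) - K1.card - K2.card) (xx ℓ i)
  else
    ∑ K1 ∈ (Jset ℓ j).powerset, ∑ K2 ∈ ((Jset ℓ j) \ K1).powerset,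
      (∏ a ∈ K1, xx ℓ a) * (∏ a ∈ K2, xx ℓ a) ^ 2 * (-zz ℓ) ^ K1.card * (-(xx ℓ j)) *
        arB B ℓ (-1) ((j : ℕ) - K1.card - K2.card) (xx ℓ i)


/-- The defining linear forms of the cone over the Shi arrangement of type `D_ℓ`:
`x_s + εx_t − z` and `x_s + εx_t` for `1 ≤ s < t ≤ ℓ`, `ε ∈ {−1,1}`, together with `z`. -/
def forms (ℓ : ℕ) : Set (SS ℓ) :=
  {f | f = X (Fin.last ℓ) ∨
    ∃ (s t : Fin ℓ) (ε : ℝ), s < t ∧ (ε = 1 ∨ ε = -1) ∧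
      (f = X s.castSucc + C ε * X t.castSucc - X (Fin.last ℓ) ∨
       f = X s.castSucc + C ε * X t.castSucc)}

section Umbral

variable {R V : Type*} [CommRing R] [AddCommGroup V] [Module R V]

/-- The linear functional that expresses `φ_j(x_i)` through the values `A p q = ar B_{p,q}(x_i, z)`. -/
def umbral (ℓ : ℕ) (x : Fin ℓ → R) (z : R) (j : Fin ℓ) (A : ℤ → ℕ → V) : V :=
  if h : (j : ℕ) + 1 < ℓ then
    (x j - x ⟨(j : ℕ) + 1, h⟩ - z) •
      ∑ K1 ∈ (Jset ℓ j).powerset, ∑ K2 ∈ ((Jset ℓ j) \ K1).powerset,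
        ((∏ a ∈ K1, x a) * (∏ a ∈ K2, x a) ^ 2 * (-z) ^ K1.card) •
          ∑ n1 ∈ Finset.range 3, ∑ n2 ∈ Finset.range (ℓ - (j : ℕ) - 1),
            ((-1 : R) ^ (n1 + n2) *
              esymVal ({j, ⟨(j : ℕ) + 1, h⟩} : Finset (Fin ℓ)) x n1 *
              esymVal (univ.filter (fun a : Fin ℓ => (j : ℕ) + 1 < (a : ℕ)))
                (fun a => x a ^ 2) n2) •
              A ((2 - (n1 : ℤ)) + 2 * ((ℓ : ℤ) - (j : ℤ) - 2 - (n2 : ℤ)) - 1)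
                ((j : ℕ) - K1.card - K2.card)
  else
    ∑ K1 ∈ (Jset ℓ j).powerset, ∑ K2 ∈ ((Jset ℓ j) \ K1).powerset,
      ((∏ a ∈ K1, x a) * (∏ a ∈ K2, x a) ^ 2 * (-z) ^ K1.card * (-(x j))) •
        A (-1) ((j : ℕ) - K1.card - K2.card)

theorem card_Jset {ℓ : ℕ} (j : Fin ℓ) : (Jset ℓ j).card = j := by
  have : Jset ℓ j = Finset.Iio j := by ext; simp [Jset]
  rw [this, Fin.card_Iio]

theorem card_add_card_le {α : Type*} [DecidableEq α] {J K1 K2 : Finset α}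
    (h1 : K1 ∈ J.powerset) (h2 : K2 ∈ (J \ K1).powerset) : K1.card + K2.card ≤ J.card := by
  rw [mem_powerset] at h1 h2
  have h := card_le_card h2
  rw [card_sdiff_of_subset h1] at h
  have := card_le_card h1
  omega

theorem umbral_mem {ℓ : ℕ} (x : Fin ℓ → R) (z : R) (j : Fin ℓ) {A : ℤ → ℕ → V}
    (W : Submodule R V)
    (hA : ∀ (p : ℤ) (q : ℕ), -1 ≤ p → p + 2 * q + 3 ≤ 2 * ℓ → A p q ∈ W) :
    umbral ℓ x z j A ∈ W := by
  have hj := j.2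
  have hJ := card_Jset j
  unfold umbral
  split_ifs with h
  · refine W.smul_mem _ (W.sum_mem fun K1 h1 => W.sum_mem fun K2 h2 => W.smul_mem _
      (W.sum_mem fun n1 hn1 => W.sum_mem fun n2 hn2 => W.smul_mem _ (hA _ _ ?_ ?_)))
    all_goals
      have := card_add_card_le h1 h2
      rw [Finset.mem_range] at hn1 hn2
      omega
  · refine W.sum_mem fun K1 h1 => W.sum_mem fun K2 h2 => W.smul_mem _ (hA _ _ le_rfl ?_)
    have := card_add_card_le h1 h2
    omega

theorem esymVal_map {α R' : Type*} [CommRing R'] (f : R →+* R') (s : Finset α) (x : α → R)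
    (n : ℕ) : f (esymVal s x n) = esymVal s (fun a => f (x a)) n := by
  simp [esymVal, map_sum, map_prod]

theorem map_umbral {R' V' : Type*} [CommRing R'] [AddCommGroup V'] [Module R' V']
    (f : R →+* R') (g : V →+ V') (hg : ∀ r v, g (r • v) = f r • g v)
    {ℓ : ℕ} (x : Fin ℓ → R) (z : R) (j : Fin ℓ) (A : ℤ → ℕ → V) :
    g (umbral ℓ x z j A) = umbral ℓ (fun a => f (x a)) (f z) j (fun p q => g (A p q)) := by
  unfold umbral
  split_ifs with h <;> simp [hg, map_sum, esymVal_map, map_prod]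

theorem umbral_add {ℓ : ℕ} (x : Fin ℓ → R) (z : R) (j : Fin ℓ) (A A' : ℤ → ℕ → V) :
    umbral ℓ x z j (fun p q => A p q + A' p q) = umbral ℓ x z j A + umbral ℓ x z j A' := by
  unfold umbral
  split_ifs with h <;> simp [smul_add, sum_add_distrib]

theorem umbral_smul {ℓ : ℕ} (x : Fin ℓ → R) (z : R) (j : Fin ℓ) (r : R) (A : ℤ → ℕ → V) :
    umbral ℓ x z j (fun p q => r • A p q) = r • umbral ℓ x z j A := by
  rw [← DistribSMul.toAddMonoidHom_apply, map_umbral (RingHom.id R)]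
  · rfl
  · intro s v
    exact smul_comm _ _ _

theorem umbral_congr {ℓ : ℕ} (x : Fin ℓ → R) (z : R) (j : Fin ℓ) {A A' : ℤ → ℕ → V}
    (h : ∀ (p : ℤ) (q : ℕ), -1 ≤ p → A p q = A' p q) :
    umbral ℓ x z j A = umbral ℓ x z j A' := by
  have h0 : umbral ℓ x z j (fun p q => A p q + (-1 : R) • A' p q) ∈ (⊥ : Submodule R V) :=
    umbral_mem x z j ⊥ fun p q hp _ => by simp [h p q hp]
  rw [umbral_add, umbral_smul, Submodule.mem_bot] at h0
  rw [neg_one_smul, ← sub_eq_add_neg, sub_eq_zero] at h0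
  exact h0

theorem sum_powerset_powerset_eq_prod {α : Type*} [DecidableEq α] (J : Finset α) (x : α → R)
    (z Y : R) :
    ∑ K1 ∈ J.powerset, ∑ K2 ∈ (J \ K1).powerset,
      (∏ a ∈ K1, x a) * (∏ a ∈ K2, x a) ^ 2 * (-z) ^ K1.card * Y ^ (J.card - K1.card - K2.card)
      = ∏ a ∈ J, (Y - z * x a + x a ^ 2) := by
  have : ∀ a ∈ J, Y - z * x a + x a ^ 2 = (-z) * x a + (x a ^ 2 + Y) := fun a _ => by ring
  rw [prod_congr rfl this, prod_add]
  refine sum_congr rfl fun K1 h1 => ?_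
  rw [prod_add, mul_sum]
  refine sum_congr rfl fun K2 h2 => ?_
  rw [mem_powerset] at h1 h2
  rw [prod_const, card_sdiff_of_subset h2, card_sdiff_of_subset h1, prod_mul_distrib, prod_const,
    prod_pow]
  ring

theorem sum_esymVal_eq_prod {α : Type*} [DecidableEq α] (s : Finset α) (f : α → R) (Y : R) :
    ∑ n ∈ range (s.card + 1), (-1) ^ n * esymVal s f n * Y ^ (s.card - n)
      = ∏ a ∈ s, (Y - f a) := by
  have : ∀ a ∈ s, Y - f a = (-1) * f a + Y := fun a _ => by ring
  rw [prod_congr rfl this, prod_add, sum_powerset]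
  refine sum_congr rfl fun n _ => ?_
  rw [esymVal, mul_sum, sum_mul]
  refine sum_congr rfl fun t ht => ?_
  rw [mem_powersetCard] at ht
  rw [prod_mul_distrib, prod_const, prod_const, card_sdiff_of_subset ht.1, ht.2]

/-- The generating product of the summation over `n_1, n_2` for the index `j`,
and its analogue for the last index. -/
def genProd (ℓ : ℕ) (x : Fin ℓ → R) (z : R) (j : Fin ℓ) (T : R) : R :=
  if h : (j : ℕ) + 1 < ℓ then
    (x j - x ⟨(j : ℕ) + 1, h⟩ - z) * ((T - x j) * (T - x ⟨(j : ℕ) + 1, h⟩) *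
      ∏ a ∈ univ.filter (fun a : Fin ℓ => (j : ℕ) + 1 < (a : ℕ)), (T ^ 2 - x a ^ 2))
  else -x j

end Umbral

theorem umbral_mul_pow {F : Type*} [Field F] {ℓ : ℕ} (x : Fin ℓ → F) (z : F) (j : Fin ℓ)
    {T : F} (hT : T ≠ 0) (w Y : F) :
    umbral ℓ x z j (fun p q => w * T ^ p * Y ^ q)
      = w * (∏ a ∈ Jset ℓ j, (Y - z * x a + x a ^ 2)) * genProd ℓ x z j T * T⁻¹ := by
  unfold umbral genProd
  rw [← sum_powerset_powerset_eq_prod, card_Jset]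
  split_ifs with h
  · have hne : j ≠ ⟨(j : ℕ) + 1, h⟩ := by
      intro h'
      have := congrArg Fin.val h'
      simp at this
    have h1 : (T - x j) * (T - x ⟨(j : ℕ) + 1, h⟩)
        = ∏ a ∈ ({j, ⟨(j : ℕ) + 1, h⟩} : Finset (Fin ℓ)), (T - x a) := by
      rw [prod_pair hne]
    have hc : (univ.filter (fun a : Fin ℓ => (j : ℕ) + 1 < (a : ℕ))).card = ℓ - j - 2 := by
      have : univ.filter (fun a : Fin ℓ => (j : ℕ) + 1 < (a : ℕ))
          = Finset.Ioi (⟨(j : ℕ) + 1, h⟩ : Fin ℓ) := by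
        ext a; simp [Fin.lt_def]
      rw [this, Fin.card_Ioi]; simp only; omega
    rw [h1, ← sum_esymVal_eq_prod, ← sum_esymVal_eq_prod, card_pair hne, hc,
      show ℓ - (j : ℕ) - 2 + 1 = ℓ - j - 1 by omega]
    have hin : ∀ k : ℕ, (∑ n1 ∈ Finset.range 3, ∑ n2 ∈ Finset.range (ℓ - (j : ℕ) - 1),
            ((-1 : F) ^ (n1 + n2) *
              esymVal ({j, ⟨(j : ℕ) + 1, h⟩} : Finset (Fin ℓ)) x n1 *
              esymVal (univ.filter (fun a : Fin ℓ => (j : ℕ) + 1 < (a : ℕ)))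
                (fun a => x a ^ 2) n2) •
              (w * T ^ ((2 - (n1 : ℤ)) + 2 * ((ℓ : ℤ) - (j : ℤ) - 2 - (n2 : ℤ)) - 1) * Y ^ k))
        = Y ^ k * (w * ((∑ n ∈ range (2 + 1), (-1) ^ n *
            esymVal ({j, ⟨(j : ℕ) + 1, h⟩} : Finset (Fin ℓ)) x n * T ^ (2 - n)) *
          (∑ n ∈ range (ℓ - (j : ℕ) - 1), (-1) ^ n *
            esymVal (univ.filter (fun a : Fin ℓ => (j : ℕ) + 1 < (a : ℕ)))
              (fun a => x a ^ 2) n * (T ^ 2) ^ (ℓ - (j : ℕ) - 2 - n))) * T⁻¹) := by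
      intro k
      rw [sum_mul_sum, mul_sum, sum_mul, mul_sum]
      refine sum_congr rfl fun n1 hn1 => ?_
      rw [mul_sum, sum_mul, mul_sum]
      refine sum_congr rfl fun n2 hn2 => ?_
      rw [Finset.mem_range] at hn1 hn2
      have hz : T ^ ((2 - (n1 : ℤ)) + 2 * ((ℓ : ℤ) - (j : ℤ) - 2 - (n2 : ℤ)) - 1)
          = T ^ (2 - n1) * (T ^ 2) ^ (ℓ - (j : ℕ) - 2 - n2) * T⁻¹ := by
        rw [← pow_mul, ← zpow_natCast, ← zpow_natCast, ← zpow_add₀ hT, ← zpow_sub_one₀ hT]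
        congr 1
        push_cast [show n1 ≤ 2 by omega, show n2 ≤ ℓ - (j : ℕ) - 2 by omega,
          show 2 ≤ ℓ - (j : ℕ) by omega, show (j : ℕ) ≤ ℓ by omega]
        ring
      rw [hz, smul_eq_mul]
      ring
    simp only [hin]
    simp only [smul_eq_mul, ← mul_assoc]
    simp only [← sum_mul]
    ring
  · simp only [smul_eq_mul, mul_sum, sum_mul, zpow_neg_one]
    refine sum_congr rfl fun K1 _ => sum_congr rfl fun K2 _ => ?_
    ring

section Transfer

variable (B : ℤ → ℕ → Polynomial ℝ)

/-- `ar B_{p,q}(x, z)` for elements of an arbitrary field. -/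
def arField {F : Type*} [Field F] (c : ℝ →+* F) (z : F) (p : ℤ) (q : ℕ) (x : F) : F :=
  if p = -1 ∧ q = 0 then -x⁻¹
  else z ^ (p + 2 * (q : ℤ)) * Polynomial.eval₂ c (x / z) (B p q)

/-- `ar B_{p,q}(x, z)` for units of an arbitrary commutative ring. -/
def arUnit {R : Type*} [CommRing R] (c : ℝ →+* R) (z : Rˣ) (p : ℤ) (q : ℕ) (x : Rˣ) : R :=
  if p = -1 ∧ q = 0 then -((x⁻¹ : Rˣ) : R)
  else ((z ^ (p + 2 * (q : ℤ)) : Rˣ) : R) *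
    Polynomial.eval₂ c ((x * z⁻¹ : Rˣ) : R) (B p q)

theorem map_arUnit {R F : Type*} [CommRing R] [Field F] (f : R →+* F) (c : ℝ →+* R)
    (z : Rˣ) (p : ℤ) (q : ℕ) (x : Rˣ) :
    f (arUnit B c z p q x) = arField B (f.comp c) (f z) p q (f x) := by
  have hmap : ∀ u : Rˣ, f (u : R) = (Units.map (f : R →* F) u : F) := fun _ => rfl
  unfold arUnit arField
  split_ifs with h
  · rw [map_neg, hmap, map_inv, Units.val_inv_eq_inv_val]
    rfl
  · rw [map_mul, Polynomial.hom_eval₂]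
    have h1 : f ((z ^ (p + 2 * (q : ℤ)) : Rˣ) : R) = f z ^ (p + 2 * (q : ℤ)) := by
      rw [hmap, map_zpow, Units.val_zpow_eq_zpow_val]
      rfl
    have h2 : f ((x * z⁻¹ : Rˣ) : R) = f x / f z := by
      rw [hmap, map_mul, map_inv, Units.val_mul, Units.val_inv_eq_inv_val, div_eq_mul_inv]
      rfl
    rw [h1, h2]

theorem phi_eq_umbral (ℓ : ℕ) (j i : Fin ℓ) :
    phi B ℓ j i = umbral ℓ (xx ℓ) (zz ℓ) j (fun p q =>
      arField B ((algebraMap (SS ℓ) (KK ℓ)).comp MvPolynomial.C) (zz ℓ) p q (xx ℓ i)) := by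
  rfl

theorem eval_eq_umbral {ℓ : ℕ} {F : Type} [Field F] (ev : SS ℓ →+* F)
    (hx : ∀ i : Fin ℓ, ev (X i.castSucc) ≠ 0) (hz : ev (X (Fin.last ℓ)) ≠ 0)
    {j i : Fin ℓ} {f : SS ℓ} (hf : algebraMap (SS ℓ) (KK ℓ) f = phi B ℓ j i) :
    ev f = umbral ℓ (fun a => ev (X a.castSucc)) (ev (X (Fin.last ℓ))) j
      (fun p q => arField B (ev.comp MvPolynomial.C) (ev (X (Fin.last ℓ))) p q
        (ev (X i.castSucc))) := by
  let T : Submonoid (SS ℓ) := (nonZeroDivisors F).comap ev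
  have hT : ∀ t : T, ev t ≠ 0 := fun t => nonZeroDivisors.ne_zero t.2
  have hT0 : T ≤ nonZeroDivisors (SS ℓ) := by
    intro t ht
    rw [mem_nonZeroDivisors_iff_ne_zero]
    rintro rfl
    exact hT ⟨0, ht⟩ (map_zero ev)
  let R := Localization T
  let f1 : R →+* KK ℓ := IsLocalization.lift (M := T) (g := algebraMap (SS ℓ) (KK ℓ))
    (fun t => (IsLocalization.map_units (KK ℓ) (⟨t, hT0 t.2⟩ : nonZeroDivisors (SS ℓ)) :))
  let f2 : R →+* F := IsLocalization.lift (M := T) (g := ev) (fun t => (hT t).isUnit)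
  have e1 : ∀ s, f1 (algebraMap (SS ℓ) R s) = algebraMap (SS ℓ) (KK ℓ) s := fun s =>
    IsLocalization.lift_eq _ s
  have e2 : ∀ s, f2 (algebraMap (SS ℓ) R s) = ev s := fun s => IsLocalization.lift_eq _ s
  have hinj : Function.Injective f1 := by
    refine (IsLocalization.lift_injective_iff _).2 fun a b => ?_
    rw [(IsLocalization.injective R hT0).eq_iff, (IsFractionRing.injective (SS ℓ) (KK ℓ)).eq_iff]
  have hun : ∀ s, ev s ≠ 0 → IsUnit (algebraMap (SS ℓ) R s) := fun s hs =>
    IsLocalization.map_units R (⟨s, mem_nonZeroDivisors_of_ne_zero hs⟩ : T)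
  obtain ⟨ux, hux⟩ := hun _ (hx i)
  obtain ⟨uz, huz⟩ := hun _ hz
  let r : R := umbral ℓ (fun a => algebraMap (SS ℓ) R (X a.castSucc))
    (algebraMap (SS ℓ) R (X (Fin.last ℓ))) j
    (fun p q => arUnit B ((algebraMap (SS ℓ) R).comp MvPolynomial.C) uz p q ux)
  have key : ∀ {F' : Type} [Field F'] (g : R →+* F') , g r =
      umbral ℓ (fun a => g (algebraMap (SS ℓ) R (X a.castSucc)))
        (g (algebraMap (SS ℓ) R (X (Fin.last ℓ)))) j
        (fun p q => arField B ((g.comp (algebraMap (SS ℓ) R)).comp MvPolynomial.C)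
          (g (algebraMap (SS ℓ) R (X (Fin.last ℓ)))) p q
          (g (algebraMap (SS ℓ) R (X i.castSucc)))) := by
    intro F' _ g
    have := map_umbral g (g : R →+ F') (fun r v => by simp)
      (fun a => algebraMap (SS ℓ) R (X a.castSucc))
      (algebraMap (SS ℓ) R (X (Fin.last ℓ))) j
      (fun p q => arUnit B ((algebraMap (SS ℓ) R).comp MvPolynomial.C) uz p q ux)
    refine this.trans ?_
    congr 1
    funext p q
    refine (map_arUnit B g _ uz p q ux).trans ?_
    rw [hux, huz]
    rfl
  have c1 : f1.comp (algebraMap (SS ℓ) R) = algebraMap (SS ℓ) (KK ℓ) := RingHom.ext e1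
  have c2 : f2.comp (algebraMap (SS ℓ) R) = ev := RingHom.ext e2
  have k1 := key f1
  have k2 := key f2
  simp only [e1, c1] at k1
  simp only [e2, c2] at k2
  have hr : r = algebraMap (SS ℓ) R f := by
    apply hinj
    rw [e1, hf, phi_eq_umbral, k1]
    rfl
  rw [← k2, hr, e2]

end Transfer

section Bernoulli

variable {B : ℤ → ℕ → Polynomial ℝ}

theorem arField_neg (hB : BProp B) {F : Type*} [Field F] (c : ℝ →+* F) (z : F) {p : ℤ} {q : ℕ}
    (hp : -1 ≤ p) (x : F) : arField B c z p q (-x) = -arField B c z p q x := by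
  unfold arField
  split_ifs with h
  · rw [inv_neg]
  · have h1 := congrArg (Polynomial.eval₂ c (x / z)) (hB.1 p q hp h)
    rw [Polynomial.eval₂_comp] at h1
    simp only [Polynomial.eval₂_neg, Polynomial.eval₂_X] at h1
    rw [neg_div, h1]
    ring

theorem arField_mul {F : Type*} [Field F] (c : ℝ →+* F) (z : F) (p : ℤ) (q : ℕ) {r : F}
    (hr : r ≠ 0) (x : F) :
    arField B c (r * z) p q (r * x) = r ^ (p + 2 * (q : ℤ)) * arField B c z p q x := by
  unfold arField
  split_ifs with h
  · obtain ⟨rfl, rfl⟩ := h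
    simp [mul_comm]
  · rw [mul_div_mul_left _ _ hr, mul_zpow, mul_assoc]

theorem arField_add (hB : BProp B) {F : Type*} [Field F] (c : ℝ →+* F) {z u v : F}
    (hz : z ≠ 0) (hu : u ≠ 0) (hv : v ≠ 0) (huv : u + v = z) {p : ℤ} {q : ℕ} (hp : -1 ≤ p) :
    (arField B c z p q u + arField B c z p q v) * (u - v)
      = z * (u ^ p - v ^ p) * (u * v) ^ q := by
  have hneg : arField B c z p q v = -arField B c z p q (-v) := by
    rw [arField_neg hB c z hp, neg_neg]
  have hu' : u / z = -v / z + 1 := by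
    field_simp
    linear_combination huv
  have hv' : v / z = -(-v / z) := by ring
  have huv' : u - v = z * (2 * (-v / z) + 1) := by
    field_simp
    linear_combination huv
  rw [hneg]
  by_cases h : p = -1 ∧ q = 0
  · obtain ⟨rfl, rfl⟩ := h
    simp only [arField, zpow_neg_one]
    subst huv
    simp only [and_self, if_true]
    field_simp
    ring
  · simp only [arField, if_neg h]
    rw [← sub_eq_add_neg, ← mul_sub]
    set E := Polynomial.eval₂ c (u / z) (B p q) - Polynomial.eval₂ c (-v / z) (B p q) with hE
    obtain ⟨n, rfl⟩ | rfl : (∃ n : ℕ, p = n) ∨ p = -1 := by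
      by_cases h0 : 0 ≤ p
      · exact Or.inl ⟨p.toNat, by omega⟩
      · right; omega
    · have h1 := congrArg (Polynomial.eval₂ c (-v / z)) (hB.2.1 n q)
      simp only [Polynomial.eval₂_mul, Polynomial.eval₂_sub, Polynomial.eval₂_comp,
        Polynomial.eval₂_add, Polynomial.eval₂_X, Polynomial.eval₂_one, Polynomial.eval₂_pow,
        Polynomial.eval₂_neg, Polynomial.eval₂_ofNat, ← hu', ← hv'] at h1
      rw [← hE] at h1
      have h2 : z ^ ((n : ℤ) + 2 * (q : ℤ)) = z ^ n * z ^ q * z ^ q := by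
        rw [← pow_add, ← pow_add, ← zpow_natCast]
        congr 1
        push_cast
        ring
      rw [h2, huv', zpow_natCast, zpow_natCast]
      calc z ^ n * z ^ q * z ^ q * E * (z * (2 * (-v / z) + 1))
          = z * z ^ n * z ^ q * z ^ q * ((2 * (-v / z) + 1) * E) := by ring
        _ = z * ((z * (u / z)) ^ n - (z * (v / z)) ^ n) * (z * (u / z)) ^ q *
              (z * (v / z)) ^ q := by
            rw [h1]; simp only [mul_pow]; ring
        _ = _ := by
            rw [mul_div_cancel₀ _ hz, mul_div_cancel₀ _ hz, mul_pow]; ring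
    · have hq : 1 ≤ q := by
        by_contra hq
        exact h ⟨rfl, by omega⟩
      obtain ⟨m, rfl⟩ : ∃ m, q = m + 1 := ⟨q - 1, by omega⟩
      have h1 := congrArg (Polynomial.eval₂ c (-v / z)) (hB.2.2 (m + 1) hq)
      simp only [Polynomial.eval₂_mul, Polynomial.eval₂_sub, Polynomial.eval₂_comp,
        Polynomial.eval₂_add, Polynomial.eval₂_X, Polynomial.eval₂_one, Polynomial.eval₂_pow,
        Polynomial.eval₂_neg, ← hu', ← hv', Nat.add_sub_cancel] at h1
      rw [← hE] at h1
      have h2 : z ^ (-1 + 2 * ((m + 1 : ℕ) : ℤ)) = z * z ^ m * z ^ m := by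
        rw [← pow_succ', ← pow_add, ← zpow_natCast]
        congr 1
        push_cast
        ring
      rw [h2, h1, zpow_neg_one, zpow_neg_one]
      calc z * z ^ m * z ^ m * -(v / z * (u / z)) ^ m * (u - v)
          = -(z * (z * (v / z)) ^ m * (z * (u / z)) ^ m * (u - v)) := by
            simp only [mul_pow]; ring
        _ = _ := by
            rw [mul_div_cancel₀ _ hz, mul_div_cancel₀ _ hz]
            field_simp
            ring

theorem umbral_arField_add (hB : BProp B) {F : Type*} [Field F] (c : ℝ →+* F) {ℓ : ℕ}
    (x : Fin ℓ → F) {z u v : F} (hz : z ≠ 0) (hu : u ≠ 0) (hv : v ≠ 0) (huv : u + v = z)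
    (hne : u - v ≠ 0) (j : Fin ℓ) :
    umbral ℓ x z j (fun p q => arField B c z p q u) +
        umbral ℓ x z j (fun p q => arField B c z p q v)
      = z / (u - v) * (∏ a ∈ Jset ℓ j, (u * v - z * x a + x a ^ 2)) *
        (genProd ℓ x z j u * u⁻¹ - genProd ℓ x z j v * v⁻¹) := by
  have h1 : umbral ℓ x z j (fun p q => arField B c z p q u + arField B c z p q v)
      = umbral ℓ x z j (fun p q => (z / (u - v)) * u ^ p * (u * v) ^ q +
          (-(z / (u - v))) * v ^ p * (u * v) ^ q) := by
    refine umbral_congr x z j fun p q hp => ?_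
    apply mul_right_cancel₀ hne
    rw [arField_add hB c hz hu hv huv hp]
    field_simp
    ring
  rw [← umbral_add, h1, umbral_add, umbral_mul_pow x z j hu, umbral_mul_pow x z j hv]
  ring

theorem genProd_eq_zero {R : Type*} [CommRing R] {ℓ : ℕ} (x : Fin ℓ → R) (z : R)
    {j s : Fin ℓ} (hj : (j : ℕ) + 1 < ℓ) (hjs : j ≤ s) : genProd ℓ x z j (x s) = 0 := by
  unfold genProd
  rw [dif_pos hj]
  by_cases h1 : s = j
  · simp [h1]
  by_cases h2 : s = ⟨(j : ℕ) + 1, hj⟩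
  · simp [h2]
  · rw [prod_eq_zero (i := s)]
    · simp
    · rw [mem_filter]
      refine ⟨mem_univ _, ?_⟩
      rw [Fin.ext_iff] at h1 h2
      rw [Fin.le_def] at hjs
      simp only at h2
      omega
    · simp

theorem genProd_neg_eq_zero {R : Type*} [CommRing R] {ℓ : ℕ} (x : Fin ℓ → R) {z : R}
    {j s t : Fin ℓ} (hj : (j : ℕ) + 1 < ℓ) (hjs : j ≤ s) (hst : s < t) (hz : x s - x t = z) :
    genProd ℓ x z j (-x t) = 0 := by
  unfold genProd
  rw [dif_pos hj]
  rw [Fin.le_def] at hjs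
  rw [Fin.lt_def] at hst
  by_cases h2 : t = ⟨(j : ℕ) + 1, hj⟩
  · have h3 : s = j := by
      rw [Fin.ext_iff] at h2 ⊢
      simp only at h2
      omega
    rw [← h2, ← hz, h3]
    ring
  · rw [prod_eq_zero (i := t)]
    · simp
    · rw [mem_filter]
      refine ⟨mem_univ _, ?_⟩
      rw [Fin.ext_iff] at h2
      simp only at h2
      omega
    · simp

/-- The combination `φ_j(x_s) + ε φ_j(x_t)` vanishes wherever `x_s + ε x_t` is `z` or `0`. -/
theorem umbral_arField_eq_zero (hB : BProp B) {F : Type*} [Field F] (c : ℝ →+* F) {ℓ : ℕ}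
    (x : Fin ℓ → F) {z ε : F} (hε : ε = 1 ∨ ε = -1) {s t : Fin ℓ} (hst : s < t) (hz : z ≠ 0)
    (hs : x s ≠ 0) (ht : x t ≠ 0) (hne : x s - ε * x t ≠ 0)
    (hH : x s + ε * x t = z ∨ x s + ε * x t = 0) (j : Fin ℓ) :
    umbral ℓ x z j (fun p q => arField B c z p q (x s)) +
      ε * umbral ℓ x z j (fun p q => arField B c z p q (x t)) = 0 := by
  have hv : ε * umbral ℓ x z j (fun p q => arField B c z p q (x t))
      = umbral ℓ x z j (fun p q => arField B c z p q (ε * x t)) := by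
    rw [← smul_eq_mul, ← umbral_smul]
    refine umbral_congr x z j fun p q hp => ?_
    obtain rfl | rfl := hε
    · simp
    · simp [arField_neg hB c z hp]
  rw [hv]
  obtain hH | hH := hH
  · have ht' : ε * x t ≠ 0 := by
      obtain rfl | rfl := hε <;> simpa using ht
    rw [umbral_arField_add hB c x hz hs ht' hH hne]
    by_cases hsj : s < j
    · rw [prod_eq_zero (i := s)]
      · ring
      · simpa [Jset] using hsj
      · rw [← hH]; ring
    · rw [not_lt] at hsj
      have hj : (j : ℕ) + 1 < ℓ := by
        have := t.2
        rw [Fin.le_def] at hsj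
        rw [Fin.lt_def] at hst
        omega
      have h1 : genProd ℓ x z j (ε * x t) = 0 := by
        obtain rfl | rfl := hε
        · rw [one_mul]
          exact genProd_eq_zero x z hj (hsj.trans hst.le)
        · rw [neg_one_mul]
          exact genProd_neg_eq_zero x hj hsj hst (by rw [← hH]; ring)
      rw [genProd_eq_zero x z hj hsj, h1]
      ring
  · have : ε * x t = -x s := by linear_combination hH
    rw [this, ← umbral_add]
    have h0 := umbral_mem x z j (A := fun p q => arField B c z p q (x s) +
      arField B c z p q (-x s)) (⊥ : Submodule F F) fun p q hp _ => by
        simp [arField_neg hB c z hp]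
    simpa using h0

theorem umbral_homogeneous {F : Type*} [Field F] {ℓ : ℕ} (x : Fin ℓ → F) (z : F) {r : F}
    (hr : r ≠ 0) (j : Fin ℓ) (A : ℤ → ℕ → F) :
    umbral ℓ (fun a => r * x a) (r * z) j (fun p q => r ^ (p + 2 * (q : ℤ)) * A p q)
      = r ^ (2 * ℓ - 2) * umbral ℓ x z j A := by
  have hesym : ∀ (α : Type) (s : Finset α) (f : α → F) (w : F) (n : ℕ),
      esymVal s (fun a => w * f a) n = w ^ n * esymVal s f n := by
    intro α s f w n
    rw [esymVal, esymVal, mul_sum]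
    refine sum_congr rfl fun t ht => ?_
    rw [prod_mul_distrib, prod_const, (mem_powersetCard.1 ht).2]
  have hj := j.2
  have hJ := card_Jset j
  unfold umbral
  split_ifs with h
  · simp only [smul_eq_mul, mul_sum]
    refine sum_congr rfl fun K1 h1 => sum_congr rfl fun K2 h2 => sum_congr rfl fun n1 hn1 =>
      sum_congr rfl fun n2 hn2 => ?_
    have := card_add_card_le h1 h2
    rw [Finset.mem_range] at hn1 hn2
    have e : r ^ (2 * ℓ - 2) = r * (r ^ K1.card * (r ^ K2.card) ^ 2 * r ^ K1.card *
        (r ^ n1 * (r ^ 2) ^ n2 *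
          r ^ ((2 - (n1 : ℤ)) + 2 * ((ℓ : ℤ) - (j : ℤ) - 2 - (n2 : ℤ)) - 1 +
            2 * (((j : ℕ) - K1.card - K2.card : ℕ) : ℤ)))) := by
      rw [← pow_mul, ← pow_mul, ← pow_add, ← pow_add, ← pow_add, ← zpow_natCast, ← zpow_natCast,
        ← zpow_natCast, ← zpow_add₀ hr, ← zpow_add₀ hr, ← zpow_one_add₀ hr]
      congr 1
      push_cast
      omega
    rw [e]
    simp only [prod_mul_distrib, prod_const, mul_pow, hesym]
    ring
  · simp only [smul_eq_mul, mul_sum]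
    refine sum_congr rfl fun K1 h1 => sum_congr rfl fun K2 h2 => ?_
    have := card_add_card_le h1 h2
    have e : r ^ (2 * ℓ - 2) = r ^ K1.card * (r ^ K2.card) ^ 2 * r ^ K1.card * r *
        r ^ (-1 + 2 * (((j : ℕ) - K1.card - K2.card : ℕ) : ℤ)) := by
      rw [← pow_mul, ← pow_add, ← pow_add, ← pow_succ]
      simp only [← zpow_natCast, ← zpow_add₀ hr]
      congr 1
      push_cast
      omega
    rw [e]
    simp only [prod_mul_distrib, prod_const, mul_pow]
    ring

end Bernoulli

section Independence

theorem natDegree_le_natDegree_diff (P : Polynomial ℝ) :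
    P.natDegree ≤ (P.comp (Polynomial.X + 1) - P).natDegree + 1 := by
  obtain h | ⟨m, hm⟩ : P.natDegree = 0 ∨ ∃ m, P.natDegree = m + 1 := by
    cases h : P.natDegree
    · exact Or.inl rfl
    · exact Or.inr ⟨_, rfl⟩
  · omega
  · rw [hm]
    refine Nat.succ_le_succ (Polynomial.le_natDegree_of_ne_zero ?_)
    have h1 : P.comp (Polynomial.X + 1) = Polynomial.taylor 1 P := by
      rw [Polynomial.taylor_apply, Polynomial.C_1]
    have h2 : (Polynomial.hasseDeriv m P).natDegree < 2 := by
      have := Polynomial.natDegree_hasseDeriv_le P m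
      omega
    rw [Polynomial.coeff_sub, h1, Polynomial.taylor_coeff, Polynomial.eval_eq_sum_range' h2]
    simp only [sum_range_succ, sum_range_zero, Polynomial.hasseDeriv_coeff]
    have h3 : P.coeff (m + 1) ≠ 0 := by
      rw [← hm, Polynomial.coeff_natDegree, Polynomial.leadingCoeff_ne_zero]
      rintro rfl
      simp at hm
    have h4 : ((m : ℝ) + 1) ≠ 0 := by positivity
    have h5 : (1 + m).choose m = m + 1 := by
      rw [add_comm, Nat.choose_succ_self_right]
    simp only [zero_add, Nat.choose_self, h5]
    rw [add_comm 1 m]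
    push_cast
    simp only [one_pow, mul_one, one_mul, add_sub_cancel_left]
    exact mul_ne_zero h4 h3

variable {B : ℤ → ℕ → Polynomial ℝ}

theorem natDegree_le (hB : BProp B) {p : ℤ} {q : ℕ} (hp : -1 ≤ p) (h : ¬(p = -1 ∧ q = 0)) :
    ((B p q).natDegree : ℤ) ≤ p + 2 * q := by
  have hd := natDegree_le_natDegree_diff (B p q)
  obtain ⟨n, rfl⟩ | rfl : (∃ n : ℕ, p = n) ∨ p = -1 := by
    by_cases h0 : 0 ≤ p
    · exact Or.inl ⟨p.toNat, by omega⟩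
    · right; omega
  · by_cases hz : (B n q).comp (Polynomial.X + 1) - B n q = 0
    · have hc : (B n q).natDegree ≤ 0 := by
        by_contra hc
        have hodd := hB.1 n q hp h
        have hev : ∀ k : ℕ, (B n q).eval (k : ℝ) = 0 := by
          intro k
          induction k with
          | zero =>
            have := congrArg (Polynomial.eval 0) hodd
            simp only [Polynomial.eval_comp, Polynomial.eval_neg, Polynomial.eval_X,
              neg_zero] at this
            push_cast
            linarith
          | succ k ih =>
            have := congrArg (Polynomial.eval (k : ℝ)) hz
            simp only [Polynomial.eval_comp, Polynomial.eval_sub, Polynomial.eval_add,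
              Polynomial.eval_X, Polynomial.eval_one, Polynomial.eval_zero] at this
            push_cast
            linarith
        have := Polynomial.eq_zero_of_infinite_isRoot (B n q)
          ((Set.infinite_range_of_injective (Nat.cast_injective (R := ℝ))).mono
            (by rintro _ ⟨k, rfl⟩; exact hev k))
        rw [this] at hc
        simp at hc
      omega
    · have h1 := congrArg Polynomial.natDegree (hB.2.1 n q)
      have h2 : (2 * Polynomial.X + 1 : Polynomial ℝ).natDegree = 1 := by compute_degree!
      have h3 : (2 * Polynomial.X + 1 : Polynomial ℝ) ≠ 0 := by
        intro h0
        rw [h0] at h2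
        simp at h2
      rw [Polynomial.natDegree_mul h3 hz, h2] at h1
      have h4 : (((Polynomial.X + 1) ^ n - (-Polynomial.X) ^ n) * (Polynomial.X + 1) ^ q *
          (-Polynomial.X) ^ q : Polynomial ℝ).natDegree ≤ n + q + q := by
        compute_degree
      omega
  · have h1 := congrArg Polynomial.natDegree (hB.2.2 q (by omega))
    have h4 : (-((-Polynomial.X) * (Polynomial.X + 1)) ^ (q - 1) : Polynomial ℝ).natDegree
        ≤ (q - 1) * 2 := by
      compute_degree
    omega

/-- The even polynomials of degree at most `n`. -/
def evenDegreeLE (n : ℕ) : Submodule ℝ (Polynomial ℝ) where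
  carrier := {P | P.comp (-Polynomial.X) = P ∧ P.natDegree ≤ n}
  zero_mem' := by simp
  add_mem' := by
    rintro P Q ⟨h1, h2⟩ ⟨h3, h4⟩
    exact ⟨by rw [Polynomial.add_comp, h1, h3], Polynomial.natDegree_add_le_of_degree_le h2 h4⟩
  smul_mem' := by
    rintro r P ⟨h1, h2⟩
    exact ⟨by rw [Polynomial.smul_comp, h1], (Polynomial.natDegree_smul_le r P).trans h2⟩

theorem eq_zero_of_mem_evenDegreeLE {ℓ : ℕ} (hℓ : 0 < ℓ) {P : Polynomial ℝ}
    (hP : P ∈ evenDegreeLE (2 * ℓ - 2)) (x : Fin ℓ → ℝ) (hx : Function.Injective x)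
    (hpos : ∀ i, 0 < x i) (h0 : ∀ i, P.eval (x i) = 0) : P = 0 := by
  refine Polynomial.eq_zero_of_natDegree_lt_card_of_eval_eq_zero P
    (f := Sum.elim x (fun i => -x i)) ?_ ?_ ?_
  · refine hx.sumElim (neg_injective.comp hx) fun a b => ?_
    have := hpos a
    have := hpos b
    intro h
    linarith
  · rintro (i | i)
    · exact h0 i
    · have := congrArg (Polynomial.eval (x i)) hP.1
      rw [Polynomial.eval_comp, h0] at this
      simpa using this
  · have := hP.2
    rw [Fintype.card_sum, Fintype.card_fin]
    omega

theorem eval_umbral_eq_zero (hB : BProp B) {ℓ : ℕ} (hℓ : 0 < ℓ) (x : Fin ℓ → ℝ)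
    (hx : Function.Injective x) (hpos : ∀ i, 0 < x i) (c : Fin ℓ → ℝ)
    (hc : ∀ i, ∑ j, c j * umbral ℓ x 1 j
      (fun p q => arField B (RingHom.id ℝ) 1 p q (x i)) = 0) {y : ℝ} (hy : y ≠ 0) :
    ∑ j, c j * umbral ℓ x 1 j (fun p q => arField B (RingHom.id ℝ) 1 p q y) = 0 := by
  let A : ℤ → ℕ → Polynomial ℝ := fun p q =>
    if p = -1 ∧ q = 0 then -1 else Polynomial.X * B p q
  have hA : ∀ (y : ℝ), y ≠ 0 → ∀ p q,
      (A p q).eval y = y * arField B (RingHom.id ℝ) 1 p q y := by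
    intro y hy p q
    simp only [A, arField]
    split_ifs with h
    · simp [hy]
    · simp [Polynomial.eval₂_id]
  let P : Polynomial ℝ := ∑ j, c j • umbral ℓ x 1 j A
  have hPe : ∀ y : ℝ, y ≠ 0 → P.eval y =
      y * ∑ j, c j * umbral ℓ x 1 j (fun p q => arField B (RingHom.id ℝ) 1 p q y) := by
    intro y hy
    simp only [P, Polynomial.eval_finsetSum, Polynomial.eval_smul, smul_eq_mul]
    rw [mul_sum]
    refine sum_congr rfl fun j _ => ?_
    have h1 := map_umbral (RingHom.id ℝ) (Polynomial.leval y).toAddMonoidHom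
      (by intro r v; simp) x 1 j A
    have h2 : (Polynomial.leval y).toAddMonoidHom (umbral ℓ x 1 j A)
      = (umbral ℓ x 1 j A).eval y := rfl
    rw [← h2, h1, mul_left_comm, ← smul_eq_mul y, ← umbral_smul]
    congr 2
    funext p q
    exact hA y hy p q
  have hP : P ∈ evenDegreeLE (2 * ℓ - 2) := by
    refine Submodule.sum_mem _ fun j _ => Submodule.smul_mem _ _ (umbral_mem _ _ _ _ ?_)
    intro p q hp hpq
    simp only [A]
    split_ifs with h
    · exact ⟨by simp, by simp⟩
    · refine ⟨by rw [Polynomial.mul_comp, hB.1 p q hp h]; simp, ?_⟩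
      have h1 := natDegree_le hB hp h
      have h2 := Polynomial.natDegree_mul_le (p := Polynomial.X) (q := B p q)
      rw [Polynomial.natDegree_X] at h2
      omega
  have hP0 : P = 0 := eq_zero_of_mem_evenDegreeLE hℓ hP x hx hpos fun i => by
    rw [hPe _ (hpos i).ne', hc, mul_zero]
  have := hPe y hy
  rw [hP0, Polynomial.eval_zero] at this
  exact (mul_eq_zero.1 this.symm).resolve_left hy

theorem ne_zero_of_eq_intCast {r : ℝ} (n : ℤ) (h : r = n) (hn : n ≠ 0) : r ≠ 0 := by
  rw [h]
  exact_mod_cast hn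

theorem umbral_diag_ne_zero (hB : BProp B) {ℓ : ℕ} (x : Fin ℓ → ℝ)
    (hx : ∀ i, x i = ((3 * ((i : ℕ) + 1) : ℤ) : ℝ)) (b : Fin ℓ) :
    umbral ℓ x 1 b (fun p q => arField B (RingHom.id ℝ) 1 p q (x b)) +
      umbral ℓ x 1 b (fun p q => arField B (RingHom.id ℝ) 1 p q (1 - x b)) ≠ 0 := by
  have hu : x b ≠ 0 :=
    ne_zero_of_eq_intCast (3 * ((b : ℕ) + 1)) (hx b) (by omega)
  have hv : 1 - x b ≠ 0 :=
    ne_zero_of_eq_intCast (1 - 3 * ((b : ℕ) + 1)) (by simp only [hx]; push_cast; ring) (by omega)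
  have huv : x b - (1 - x b) ≠ 0 :=
    ne_zero_of_eq_intCast (6 * ((b : ℕ) + 1) - 1) (by simp only [hx]; push_cast; ring) (by omega)
  rw [umbral_arField_add hB _ x one_ne_zero hu hv (by ring) huv]
  refine mul_ne_zero (mul_ne_zero (div_ne_zero one_ne_zero huv) ?_) ?_
  · refine prod_ne_zero_iff.2 fun a ha => ?_
    have hab : (a : ℕ) < b := by simpa [Jset] using ha
    have : x b * (1 - x b) - 1 * x a + x a ^ 2 = (x a - x b) * (x a - (1 - x b)) := by ring
    rw [this]
    exact mul_ne_zero
      (ne_zero_of_eq_intCast (3 * (a : ℕ) - 3 * (b : ℕ))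
        (by simp only [hx]; push_cast; ring) (by omega))
      (ne_zero_of_eq_intCast (3 * ((a : ℕ) + 1) + 3 * ((b : ℕ) + 1) - 1)
        (by simp only [hx]; push_cast; ring) (by omega))
  · by_cases h : (b : ℕ) + 1 < ℓ
    · rw [genProd_eq_zero x 1 h le_rfl, zero_mul, zero_sub]
      refine neg_ne_zero.2 (mul_ne_zero ?_ (inv_ne_zero hv))
      unfold genProd
      rw [dif_pos h]
      refine mul_ne_zero ?_ (mul_ne_zero (mul_ne_zero ?_ ?_) (prod_ne_zero_iff.2 fun a _ => ?_))
      · exact ne_zero_of_eq_intCast (-4) (by simp only [hx]; push_cast; ring) (by omega)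
      · exact ne_zero_of_eq_intCast (1 - 6 * ((b : ℕ) + 1))
          (by simp only [hx]; push_cast; ring) (by omega)
      · exact ne_zero_of_eq_intCast (1 - 6 * ((b : ℕ) + 1) - 3)
          (by simp only [hx]; push_cast; ring) (by omega)
      · rw [sq_sub_sq]
        exact mul_ne_zero
          (ne_zero_of_eq_intCast (1 - 3 * ((b : ℕ) + 1) + 3 * ((a : ℕ) + 1))
            (by simp only [hx]; push_cast; ring) (by omega))
          (ne_zero_of_eq_intCast (1 - 3 * ((b : ℕ) + 1) - 3 * ((a : ℕ) + 1))
            (by simp only [hx]; push_cast; ring) (by omega))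
    · unfold genProd
      rw [dif_neg h, dif_neg h]
      have : -x b * (x b)⁻¹ - -x b * (1 - x b)⁻¹ = (x b - (1 - x b)) * (1 - x b)⁻¹ := by
        field_simp
        ring
      rw [this]
      exact mul_ne_zero huv (inv_ne_zero hv)

theorem det_umbral_ne_zero (hB : BProp B) {ℓ : ℕ} (hℓ : 0 < ℓ) (x : Fin ℓ → ℝ)
    (hx : ∀ i, x i = ((3 * ((i : ℕ) + 1) : ℤ) : ℝ)) :
    (Matrix.of fun i j : Fin ℓ => umbral ℓ x 1 j
      (fun p q => arField B (RingHom.id ℝ) 1 p q (x i))).det ≠ 0 := by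
  have hinj : Function.Injective x := by
    intro a b hab
    rw [hx, hx] at hab
    have : (3 * ((a : ℕ) + 1) : ℤ) = 3 * ((b : ℕ) + 1) := by exact_mod_cast hab
    rw [Fin.ext_iff]
    omega
  have hpos : ∀ i, 0 < x i := by
    intro i
    rw [hx]
    push_cast
    positivity
  intro hdet
  obtain ⟨c, hc0, hc⟩ := Matrix.exists_mulVec_eq_zero_iff.2 hdet
  apply hc0
  have hc' : ∀ i, ∑ j, c j * umbral ℓ x 1 j
      (fun p q => arField B (RingHom.id ℝ) 1 p q (x i)) = 0 := by
    intro i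
    have := congrFun hc i
    simp only [Matrix.mulVec, dotProduct, Matrix.of_apply, Pi.zero_apply] at this
    rw [← this]
    exact sum_congr rfl fun j _ => mul_comm _ _
  have hall := fun {y : ℝ} => eval_umbral_eq_zero hB hℓ x hinj hpos c hc' (y := y)
  have hind : ∀ (n : ℕ) (b : Fin ℓ), (b : ℕ) = n → c b = 0 := by
    intro n
    induction n using Nat.strong_induction_on with
    | _ n ih =>
      intro b hb
      have hu : x b ≠ 0 := (hpos b).ne'
      have hv : 1 - x b ≠ 0 :=
    ne_zero_of_eq_intCast (1 - 3 * ((b : ℕ) + 1)) (by simp only [hx]; push_cast; ring) (by omega)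
      have huv : x b - (1 - x b) ≠ 0 :=
    ne_zero_of_eq_intCast (6 * ((b : ℕ) + 1) - 1) (by simp only [hx]; push_cast; ring) (by omega)
      have h1 := hall hu
      have h2 := hall hv
      have h3 : ∑ j, c j * (umbral ℓ x 1 j (fun p q => arField B (RingHom.id ℝ) 1 p q (x b)) +
          umbral ℓ x 1 j (fun p q => arField B (RingHom.id ℝ) 1 p q (1 - x b))) = 0 := by
        simp only [mul_add, sum_add_distrib, h1, h2, add_zero]
      rw [sum_eq_single b] at h3
      · exact (mul_eq_zero.1 h3).resolve_right (umbral_diag_ne_zero hB x hx b)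
      · intro j _ hjb
        obtain h | h := lt_or_gt_of_ne (fun h => hjb (Fin.ext h) : (j : ℕ) ≠ b)
        · rw [ih j (by omega) j rfl, zero_mul]
        · rw [umbral_arField_add hB _ x one_ne_zero hu hv (by ring) huv,
            prod_eq_zero (i := b)]
          · ring
          · simpa [Jset] using h
          · ring
      · simp
  funext b
  exact hind b b rfl

end Independence

section LinearForms

/-- The linear form `x_s + ε x_t - δ z`. -/
def linForm (ℓ : ℕ) (s t : Fin ℓ) (ε δ : ℝ) : SS ℓ :=
  X s.castSucc + C ε * X t.castSucc - C δ * X (Fin.last ℓ)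

/-- The substitution `x_s ↦ δ z - ε x_t`. -/
def linSubst (ℓ : ℕ) (s t : Fin ℓ) (ε δ : ℝ) : SS ℓ →ₐ[ℝ] SS ℓ :=
  aeval fun p => if p = s.castSucc then C δ * X (Fin.last ℓ) - C ε * X t.castSucc else X p

theorem linSubst_X_of_ne {ℓ : ℕ} (s t : Fin ℓ) (ε δ : ℝ) {p : Fin (ℓ + 1)} (h : p ≠ s.castSucc) :
    linSubst ℓ s t ε δ (X p) = X p := by
  simp [linSubst, h]

theorem linSubst_X_self {ℓ : ℕ} (s t : Fin ℓ) (ε δ : ℝ) :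
    linSubst ℓ s t ε δ (X s.castSucc) = C δ * X (Fin.last ℓ) - C ε * X t.castSucc := by
  simp [linSubst]

theorem last_ne_castSucc {ℓ : ℕ} (s : Fin ℓ) : Fin.last ℓ ≠ s.castSucc :=
  (Fin.castSucc_lt_last s).ne'

theorem linSubst_linForm {ℓ : ℕ} {s t : Fin ℓ} (hst : s ≠ t) (ε δ : ℝ) :
    linSubst ℓ s t ε δ (linForm ℓ s t ε δ) = 0 := by
  have h : t.castSucc ≠ s.castSucc := fun h => hst (Fin.castSucc_injective _ h).symm
  have hC : ∀ a, linSubst ℓ s t ε δ (C a) = C a := fun a => by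
    simp [linSubst]
  simp only [linForm, map_sub, map_add, map_mul, linSubst_X_self,
    linSubst_X_of_ne s t ε δ h, linSubst_X_of_ne s t ε δ (last_ne_castSucc s), hC]
  ring

theorem linForm_dvd_sub_linSubst {ℓ : ℕ} (s t : Fin ℓ) (ε δ : ℝ) (f : SS ℓ) :
    linForm ℓ s t ε δ ∣ f - linSubst ℓ s t ε δ f := by
  let I : Ideal (SS ℓ) := Ideal.span {linForm ℓ s t ε δ}
  have h : (Ideal.Quotient.mkₐ ℝ I).comp (linSubst ℓ s t ε δ) = Ideal.Quotient.mkₐ ℝ I := by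
    refine MvPolynomial.algHom_ext fun p => ?_
    by_cases hp : p = s.castSucc
    · subst hp
      rw [AlgHom.comp_apply, linSubst_X_self, Ideal.Quotient.mkₐ_eq_mk, Ideal.Quotient.eq,
        Ideal.mem_span_singleton]
      exact ⟨-1, by rw [linForm]; ring⟩
    · rw [AlgHom.comp_apply, linSubst_X_of_ne _ _ _ _ hp]
  rw [← Ideal.mem_span_singleton, ← Ideal.Quotient.eq]
  exact (DFunLike.congr_fun h f).symm

theorem linForm_dvd_iff {ℓ : ℕ} {s t : Fin ℓ} (hst : s ≠ t) (ε δ : ℝ) (f : SS ℓ) :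
    linForm ℓ s t ε δ ∣ f ↔ linSubst ℓ s t ε δ f = 0 := by
  constructor
  · rintro ⟨g, rfl⟩
    rw [map_mul, linSubst_linForm hst, zero_mul]
  · intro h
    have := linForm_dvd_sub_linSubst s t ε δ f
    rwa [h, sub_zero] at this

theorem linForm_ne_zero {ℓ : ℕ} {s t : Fin ℓ} (hst : s ≠ t) (ε δ : ℝ) :
    linForm ℓ s t ε δ ≠ 0 := by
  intro h
  have h1 := congrArg (eval fun p => if p = s.castSucc then (1 : ℝ) else 0) h
  have h2 : t.castSucc ≠ s.castSucc := fun h => hst (Fin.castSucc_injective _ h).symm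
  simp [linForm, h2, last_ne_castSucc s] at h1

theorem prime_linForm {ℓ : ℕ} {s t : Fin ℓ} (hst : s ≠ t) (ε δ : ℝ) :
    Prime (linForm ℓ s t ε δ) := by
  refine ⟨linForm_ne_zero hst ε δ, ?_, ?_⟩
  · intro hu
    have := (linForm_dvd_iff hst ε δ 1).1 hu.dvd
    simp at this
  · intro f g h
    rw [linForm_dvd_iff hst, map_mul, mul_eq_zero] at h
    rwa [linForm_dvd_iff hst, linForm_dvd_iff hst]

/-- Distinct forms `x_s + ε x_t - δ z` with `s < t` and `ε = ±1` do not divide each other. -/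
theorem eq_of_linForm_dvd {ℓ : ℕ} {s t s' t' : Fin ℓ} {ε δ ε' δ' : ℝ} (hst : s < t)
    (hst' : s' < t') (hε : ε = 1 ∨ ε = -1) (hε' : ε' = 1 ∨ ε' = -1)
    (h : linForm ℓ s t ε δ ∣ linForm ℓ s' t' ε' δ') : s = s' ∧ t = t' ∧ ε = ε' ∧ δ = δ' := by
  have hev : ∀ (v : Fin ℓ → ℝ) (w : ℝ), v s + ε * v t - δ * w = 0 →
      v s' + ε' * v t' - δ' * w = 0 := by
    intro v w h0
    have h1 := map_dvd (eval (Fin.snoc v w : Fin (ℓ + 1) → ℝ)) h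
    simp only [linForm, map_sub, map_add, map_mul, eval_X, eval_C, Fin.snoc_castSucc,
      Fin.snoc_last] at h1
    rw [h0] at h1
    exact zero_dvd_iff.1 h1
  have hε0 : ε' ≠ 0 := by obtain rfl | rfl := hε' <;> norm_num
  have hs : s' = s ∨ s' = t := by
    by_contra hn
    rw [not_or] at hn
    have := hev (fun p => if p = s' then 1 else 0) 0 (by simp [Ne.symm hn.1, Ne.symm hn.2])
    simp [hst'.ne'] at this
  have ht : t' = s ∨ t' = t := by
    by_contra hn
    rw [not_or] at hn
    have := hev (fun p => if p = t' then 1 else 0) 0 (by simp [Ne.symm hn.1, Ne.symm hn.2])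
    simp [hst'.ne, hε0] at this
  have h1 : s = s' ∧ t = t' := by
    obtain rfl | rfl := hs
    · obtain rfl | rfl := ht
      · exact absurd hst' (lt_irrefl _)
      · exact ⟨rfl, rfl⟩
    · obtain rfl | rfl := ht
      · exact absurd (hst.trans hst') (lt_irrefl _)
      · exact absurd hst' (lt_irrefl _)
  obtain ⟨rfl, rfl⟩ := h1
  refine ⟨rfl, rfl, ?_, ?_⟩
  · have := hev (fun p => if p = s then 1 else if p = t then -ε else 0) 0 (by
      obtain rfl | rfl := hε <;> simp [hst.ne'])
    obtain rfl | rfl := hε <;> obtain rfl | rfl := hε' <;> simp [hst.ne'] at this ⊢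
  · have := hev (fun p => if p = s then δ else 0) 1 (by simp [hst.ne'])
    simp [hst.ne'] at this
    linarith

theorem linSubst_X_ne_zero {ℓ : ℕ} {s t : Fin ℓ} {ε : ℝ} (hε : ε ≠ 0) (δ : ℝ)
    (p : Fin (ℓ + 1)) : linSubst ℓ s t ε δ (X p) ≠ 0 := by
  by_cases hp : p = s.castSucc
  · subst hp
    rw [linSubst_X_self]
    intro h
    have h1 := congrArg (eval fun p => if p = t.castSucc then (1 : ℝ) else 0) h
    simp [last_ne_castSucc t, hε] at h1
  · rw [linSubst_X_of_ne _ _ _ _ hp]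
    exact X_ne_zero p

theorem linForm_dvd_phi {B : ℤ → ℕ → Polynomial ℝ} (hB : BProp B) {ℓ : ℕ} {s t : Fin ℓ}
    (hst : s < t) {ε δ : ℝ} (hε : ε = 1 ∨ ε = -1) (hδ : δ = 1 ∨ δ = 0) {j : Fin ℓ} {f g : SS ℓ}
    (hf : algebraMap (SS ℓ) (KK ℓ) f = phi B ℓ j s)
    (hg : algebraMap (SS ℓ) (KK ℓ) g = phi B ℓ j t) :
    linForm ℓ s t ε δ ∣ f + C ε * g := by
  rw [linForm_dvd_iff hst.ne]
  have hε0 : ε ≠ 0 := by obtain rfl | rfl := hε <;> norm_num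
  have hinj : Function.Injective (algebraMap (SS ℓ) (KK ℓ)) := IsFractionRing.injective _ _
  let ev : SS ℓ →+* KK ℓ := (algebraMap (SS ℓ) (KK ℓ)).comp (linSubst ℓ s t ε δ).toRingHom
  have hevd : ∀ f, ev f = algebraMap (SS ℓ) (KK ℓ) (linSubst ℓ s t ε δ f) := fun _ => rfl
  have hX : ∀ p, ev (X p) ≠ 0 := by
    intro p
    rw [hevd, Ne, map_eq_zero_iff _ hinj]
    exact linSubst_X_ne_zero hε0 δ p
  have hC : ev (C ε) = 1 ∨ ev (C ε) = -1 := by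
    obtain rfl | rfl := hε
    · left; simp
    · right; simp
  have h0 : ev (linForm ℓ s t ε δ) = 0 := by
    rw [hevd, linSubst_linForm hst.ne, map_zero]
  have hne : ev (X s.castSucc) - ev (C ε) * ev (X t.castSucc) ≠ 0 := by
    rw [← map_mul, ← map_sub, hevd, Ne, map_eq_zero_iff _ hinj, ← linForm_dvd_iff hst.ne]
    intro h
    have h' : linForm ℓ s t ε δ ∣ linForm ℓ s t (-ε) 0 := by
      convert h using 1
      simp [linForm, sub_eq_add_neg]
    have := (eq_of_linForm_dvd hst hst hε (by
      obtain rfl | rfl := hε <;> simp) h').2.2.1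
    apply hε0
    linarith
  have key := umbral_arField_eq_zero hB (ev.comp C) (fun a => ev (X a.castSucc)) hC hst
    (hX (Fin.last ℓ)) (hX _) (hX _) hne (by
      obtain rfl | rfl := hδ
      · left
        simp only [linForm, map_sub, map_add, map_mul, map_one, one_mul] at h0
        linear_combination h0
      · right
        simp only [linForm, map_add, map_mul, map_zero, zero_mul, sub_zero] at h0
        exact h0) j
  apply hinj
  rw [← hevd, map_zero, map_add, map_mul, eval_eq_umbral B ev (fun i => hX _) (hX _) hf,
    eval_eq_umbral B ev (fun i => hX _) (hX _) hg]
  exact key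

theorem linForm_dvd_det {ℓ : ℕ} {s t : Fin ℓ} (hst : s ≠ t) (ε δ : ℝ)
    (N : Matrix (Fin ℓ) (Fin ℓ) (SS ℓ))
    (hN : ∀ j, linForm ℓ s t ε δ ∣ N s j + C ε * N t j) : linForm ℓ s t ε δ ∣ N.det := by
  rw [← Matrix.det_updateRow_add_smul_self N hst (C ε), linForm_dvd_iff hst, AlgHom.map_det]
  refine Matrix.det_eq_zero_of_row_eq_zero s fun j => ?_
  rw [AlgHom.mapMatrix_apply, Matrix.map_apply, Matrix.updateRow_self, ← linForm_dvd_iff hst]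
  exact hN j

/-- Indices `(s, t, ε, δ)` of the linear forms `x_s + ε x_t - δ z` of the arrangement. -/
def formIndex (ℓ : ℕ) : Finset ((Fin ℓ × Fin ℓ) × (Bool × Bool)) :=
  (univ.filter fun p : Fin ℓ × Fin ℓ => p.1 < p.2) ×ˢ univ

/-- The linear form of an index. -/
def indexForm (ℓ : ℕ) (k : (Fin ℓ × Fin ℓ) × (Bool × Bool)) : SS ℓ :=
  linForm ℓ k.1.1 k.1.2 (if k.2.1 then 1 else -1) (if k.2.2 then 1 else 0)

theorem card_formIndex (ℓ : ℕ) : (formIndex ℓ).card = ℓ * (2 * ℓ - 2) := by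
  have h1 : (univ.filter fun p : Fin ℓ × Fin ℓ => p.1 < p.2).card = ∑ i ∈ range ℓ, i := by
    rw [card_filter, Fintype.sum_prod_type_right, ← Fin.sum_univ_eq_sum_range (fun i => i)]
    refine sum_congr rfl fun t _ => ?_
    rw [← card_filter]
    exact card_Jset t
  have h2 := Finset.sum_range_id_mul_two ℓ
  rw [formIndex, card_product, h1]
  simp only [card_univ, Fintype.card_prod, Fintype.card_bool]
  have h3 : ℓ * (2 * ℓ - 2) = 2 * (ℓ * (ℓ - 1)) := by
    rw [show 2 * ℓ - 2 = 2 * (ℓ - 1) by omega]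
    ring
  rw [h3, ← h2]
  ring

theorem prod_indexForm_dvd {ℓ : ℕ} {f : SS ℓ} (h : ∀ k ∈ formIndex ℓ, indexForm ℓ k ∣ f) :
    ∏ k ∈ formIndex ℓ, indexForm ℓ k ∣ f := by
  refine Finset.prod_dvd_of_isRelPrime ?_ h
  intro k hk k' hk' hne
  have hk1 : k.1.1 < k.1.2 := by simpa [formIndex] using hk
  have hk2 : k'.1.1 < k'.1.2 := by simpa [formIndex] using hk'
  refine ((prime_linForm hk1.ne _ _).irreducible.isRelPrime_iff_not_dvd).2 fun hd => hne ?_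
  obtain ⟨h1, h2, h3, h4⟩ := eq_of_linForm_dvd hk1 hk2 (by split_ifs <;> simp)
    (by split_ifs <;> simp) hd
  obtain ⟨⟨s, t⟩, ⟨b, d⟩⟩ := k
  obtain ⟨⟨s', t'⟩, ⟨b', d'⟩⟩ := k'
  simp only at h1 h2 h3 h4
  subst h1 h2
  have hb : b = b' := by
    cases b <;> cases b' <;> first | rfl | (norm_num at h3)
  have hd : d = d' := by
    cases d <;> cases d' <;> first | rfl | (norm_num at h4)
  rw [hb, hd]

theorem isHomogeneous_linForm {ℓ : ℕ} (s t : Fin ℓ) (ε δ : ℝ) :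
    (linForm ℓ s t ε δ).IsHomogeneous 1 :=
  ((isHomogeneous_X ℝ _).add (isHomogeneous_C_mul_X _ _)).sub (isHomogeneous_C_mul_X _ _)

theorem totalDegree_prod_indexForm (ℓ : ℕ) :
    (∏ k ∈ formIndex ℓ, indexForm ℓ k) ≠ 0 ∧
      (∏ k ∈ formIndex ℓ, indexForm ℓ k).totalDegree = ℓ * (2 * ℓ - 2) := by
  have h0 : (∏ k ∈ formIndex ℓ, indexForm ℓ k) ≠ 0 := by
    refine prod_ne_zero_iff.2 fun k hk => ?_
    have hk1 : k.1.1 < k.1.2 := by simpa [formIndex] using hk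
    exact linForm_ne_zero hk1.ne _ _
  refine ⟨h0, ?_⟩
  have := IsHomogeneous.prod (formIndex ℓ) (indexForm ℓ) (fun _ => 1)
    fun k _ => isHomogeneous_linForm _ _ _ _
  rw [this.totalDegree h0]
  simp [card_formIndex]

end LinearForms

section Saito

theorem isHomogeneous_of_scale {σ : Type*} {f : MvPolynomial σ ℝ} {n : ℕ}
    (h : aeval (fun p => C 2 * X p : σ → MvPolynomial σ ℝ) f = C (2 ^ n) * f) :
    f.IsHomogeneous n := by
  classical
  have hc : ∀ (f : MvPolynomial σ ℝ) (m : σ →₀ ℕ),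
      coeff m (aeval (fun p => C 2 * X p : σ → MvPolynomial σ ℝ) f)
        = 2 ^ m.degree * coeff m f := by
    intro f m
    induction f using MvPolynomial.induction_on' with
    | monomial u a =>
      have : aeval (fun p => C 2 * X p : σ → MvPolynomial σ ℝ) (monomial u a)
          = C (2 ^ u.degree) * monomial u a := by
        rw [aeval_monomial, monomial_eq, Finsupp.prod, Finsupp.prod]
        simp only [mul_pow, prod_mul_distrib, prod_pow_eq_pow_sum, Finsupp.degree_apply,
          MvPolynomial.algebraMap_eq, C_pow]
        ring
      rw [this, coeff_C_mul, coeff_monomial]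
      split_ifs with hu
      · rw [hu]
      · simp
    | add p q hp hq => rw [map_add, coeff_add, coeff_add, hp, hq]; ring
  intro d hd
  have h1 := hc f d
  rw [h, coeff_C_mul] at h1
  have h2 := mul_right_cancel₀ hd h1
  have h3 := pow_right_injective₀ (by norm_num : (0 : ℝ) < 2) (by norm_num) h2
  exact (DFunLike.congr_fun (Finsupp.degree_eq_weight_one (R := ℕ)) d).symm.trans h3.symm

variable {B : ℤ → ℕ → Polynomial ℝ}

theorem isHomogeneous_of_phi {ℓ : ℕ} {j i : Fin ℓ} {f : SS ℓ}
    (hf : algebraMap (SS ℓ) (KK ℓ) f = phi B ℓ j i) : f.IsHomogeneous (2 * ℓ - 2) := by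
  apply isHomogeneous_of_scale
  have hinj : Function.Injective (algebraMap (SS ℓ) (KK ℓ)) := IsFractionRing.injective _ _
  let sc : SS ℓ →ₐ[ℝ] SS ℓ := aeval (fun p => C 2 * X p)
  let ev : SS ℓ →+* KK ℓ := (algebraMap (SS ℓ) (KK ℓ)).comp sc.toRingHom
  have hevd : ∀ f, ev f = algebraMap (SS ℓ) (KK ℓ) (sc f) := fun _ => rfl
  have h2 : (C 2 : SS ℓ) ≠ 0 := by simp
  set r : KK ℓ := algebraMap (SS ℓ) (KK ℓ) (C 2) with hr
  have hr0 : r ≠ 0 := by rwa [hr, Ne, map_eq_zero_iff _ hinj]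
  have hX : ∀ p, ev (X p) = r * algebraMap (SS ℓ) (KK ℓ) (X p) := by
    intro p
    rw [hevd, hr, ← map_mul]
    simp [sc]
  have hX0 : ∀ p, ev (X p) ≠ 0 := by
    intro p
    rw [hX]
    exact mul_ne_zero hr0 (by rw [Ne, map_eq_zero_iff _ hinj]; exact X_ne_zero p)
  have hc : ev.comp C = (algebraMap (SS ℓ) (KK ℓ)).comp C := by
    refine RingHom.ext fun a => ?_
    change algebraMap (SS ℓ) (KK ℓ) (sc (C a)) = algebraMap (SS ℓ) (KK ℓ) (C a)
    rw [show sc (C a) = C a by simp [sc]]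
  apply hinj
  refine (eval_eq_umbral B ev (fun i => hX0 _) (hX0 _) hf).trans ?_
  rw [map_mul, C_pow, map_pow, hf, phi_eq_umbral, hc]
  simp only [hX, arField_mul _ _ _ _ hr0]
  exact umbral_homogeneous (xx ℓ) (zz ℓ) hr0 j _

theorem isHomogeneous_det {σ n : Type*} [Fintype n] [DecidableEq n]
    (M : Matrix n n (MvPolynomial σ ℝ)) {d : ℕ} (h : ∀ i j, (M i j).IsHomogeneous d) :
    M.det.IsHomogeneous (Fintype.card n * d) := by
  rw [Matrix.det_apply]
  refine IsHomogeneous.sum _ _ _ fun g _ => ?_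
  have h1 := IsHomogeneous.prod univ (fun i => M (g i) i) (fun _ => d) fun i _ => h _ _
  rw [sum_const, card_univ, smul_eq_mul] at h1
  obtain h2 | h2 := Int.units_eq_one_or (Equiv.Perm.sign g)
  · rw [h2, one_smul]; exact h1
  · rw [h2, Units.neg_smul, one_smul]; exact h1.neg

theorem det_ne_zero (hB : BProp B) {ℓ : ℕ} (hℓ : 0 < ℓ) (M : Matrix (Fin ℓ) (Fin ℓ) (SS ℓ))
    (hM : ∀ i j, algebraMap (SS ℓ) (KK ℓ) (M i j) = phi B ℓ j i) : M.det ≠ 0 := by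
  intro h0
  let x : Fin ℓ → ℝ := fun i => ((3 * ((i : ℕ) + 1) : ℤ) : ℝ)
  let ev : SS ℓ →+* ℝ := eval (Fin.snoc x 1 : Fin (ℓ + 1) → ℝ)
  have hx : ∀ i, ev (X (Fin.castSucc i)) = x i := fun i => by simp [ev]
  have hz : ev (X (Fin.last ℓ)) = 1 := by simp [ev]
  have hc : ev.comp C = RingHom.id ℝ := RingHom.ext fun a => by simp [ev]
  have hpos : ∀ i, ev (X (Fin.castSucc i)) ≠ 0 := fun i => by
    rw [hx]
    exact ne_zero_of_eq_intCast _ rfl (by omega)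
  apply det_umbral_ne_zero hB hℓ x (fun _ => rfl)
  rw [← map_zero ev, ← h0, RingHom.map_det]
  congr 1
  ext i j
  have := eval_eq_umbral B ev hpos (by rw [hz]; exact one_ne_zero) (hM i j)
  rw [RingHom.mapMatrix_apply, Matrix.map_apply, this, Matrix.of_apply]
  simp only [hx, hz, hc]

theorem exists_det_eq (hB : BProp B) {ℓ : ℕ} (hℓ : 0 < ℓ) (M : Matrix (Fin ℓ) (Fin ℓ) (SS ℓ))
    (hM : ∀ i j, algebraMap (SS ℓ) (KK ℓ) (M i j) = phi B ℓ j i) :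
    ∃ r : ℝ, r ≠ 0 ∧ M.det = C r * ∏ k ∈ formIndex ℓ, indexForm ℓ k := by
  have h0 := det_ne_zero hB hℓ M hM
  obtain ⟨hQ0, hQ⟩ := totalDegree_prod_indexForm ℓ
  have hd : ∏ k ∈ formIndex ℓ, indexForm ℓ k ∣ M.det := by
    refine prod_indexForm_dvd fun k hk => ?_
    have hk1 : k.1.1 < k.1.2 := by simpa [formIndex] using hk
    exact linForm_dvd_det hk1.ne _ _ M fun j => linForm_dvd_phi hB hk1
      (by split_ifs <;> simp) (by split_ifs <;> simp) (hM _ j) (hM _ j)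
  obtain ⟨g, hg⟩ := hd
  have hg0 : g ≠ 0 := by
    rintro rfl
    exact h0 (by rw [hg, mul_zero])
  have h1 := (isHomogeneous_det M fun i j => isHomogeneous_of_phi (hM i j)).totalDegree h0
  rw [Fintype.card_fin, hg, totalDegree_mul_of_isDomain hQ0 hg0, hQ] at h1
  have h2 := totalDegree_eq_zero_iff_eq_C.1 (by omega : g.totalDegree = 0)
  refine ⟨coeff 0 g, ?_, by rw [← h2, hg, mul_comm]⟩
  intro h
  rw [h, C_0] at h2
  exact hg0 h2

/-- Saito's criterion for the square matrix of the values `φ_j(x_i)`. -/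
theorem exists_mulVec_eq (hB : BProp B) {ℓ : ℕ} (hℓ : 0 < ℓ)
    (M : Matrix (Fin ℓ) (Fin ℓ) (SS ℓ))
    (hM : ∀ i j, algebraMap (SS ℓ) (KK ℓ) (M i j) = phi B ℓ j i) (b : Fin ℓ → SS ℓ)
    (hb : ∀ (s t : Fin ℓ) (ε δ : ℝ), s < t → (ε = 1 ∨ ε = -1) → (δ = 1 ∨ δ = 0) →
      linForm ℓ s t ε δ ∣ b s + C ε * b t) :
    ∃ c : Fin ℓ → SS ℓ, M.mulVec c = b := by
  obtain ⟨r, hr, hdet⟩ := exists_det_eq hB hℓ M hM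
  obtain ⟨hQ0, -⟩ := totalDegree_prod_indexForm ℓ
  have hdvd : ∀ j, ∏ k ∈ formIndex ℓ, indexForm ℓ k ∣ M.cramer b j := by
    intro j
    rw [Matrix.cramer_apply]
    refine prod_indexForm_dvd fun k hk => ?_
    have hk1 : k.1.1 < k.1.2 := by simpa [formIndex] using hk
    refine linForm_dvd_det hk1.ne _ _ _ fun m => ?_
    by_cases hm : m = j
    · subst hm
      rw [Matrix.updateCol_self, Matrix.updateCol_self]
      exact hb _ _ _ _ hk1 (by split_ifs <;> simp) (by split_ifs <;> simp)
    · rw [Matrix.updateCol_ne hm, Matrix.updateCol_ne hm]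
      exact linForm_dvd_phi hB hk1
        (by split_ifs <;> simp) (by split_ifs <;> simp) (hM _ m) (hM _ m)
  choose d hd using hdvd
  refine ⟨fun j => C r⁻¹ * d j, ?_⟩
  have h1 := Matrix.mulVec_cramer M b
  have h2 : M.cramer b = (∏ k ∈ formIndex ℓ, indexForm ℓ k) • d := by
    funext j
    rw [hd, Pi.smul_apply, smul_eq_mul]
  have h3 : (fun j => C r⁻¹ * d j) = (C r⁻¹ : SS ℓ) • d := rfl
  have h4 : (C r⁻¹ : SS ℓ) * C r = 1 := by
    rw [← C_mul, inv_mul_cancel₀ hr, C_1]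
  rw [h2, Matrix.mulVec_smul, hdet] at h1
  rw [h3, Matrix.mulVec_smul]
  funext i
  have h5 := congrFun h1 i
  simp only [Pi.smul_apply, smul_eq_mul] at h5 ⊢
  have h6 : M.mulVec d i = C r * b i := by
    apply mul_left_cancel₀ hQ0
    rw [h5]; ring
  rw [h6, ← mul_assoc, h4, one_mul]

theorem derivation_linForm {ℓ : ℕ} (D : Derivation ℝ (SS ℓ) (SS ℓ)) (s t : Fin ℓ) (ε δ : ℝ) :
    D (linForm ℓ s t ε δ)
      = D (X s.castSucc) + C ε * D (X t.castSucc) - C δ * D (X (Fin.last ℓ)) := by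
  simp [linForm, C_mul']

theorem mem_forms_iff {ℓ : ℕ} (α : SS ℓ) :
    α ∈ forms ℓ ↔ α = X (Fin.last ℓ) ∨ ∃ (s t : Fin ℓ) (ε δ : ℝ), s < t ∧ (ε = 1 ∨ ε = -1) ∧
      (δ = 1 ∨ δ = 0) ∧ α = linForm ℓ s t ε δ := by
  refine or_congr Iff.rfl ⟨?_, ?_⟩
  · rintro ⟨s, t, ε, hst, hε, rfl | rfl⟩
    · exact ⟨s, t, ε, 1, hst, hε, Or.inl rfl, by simp [linForm]⟩
    · exact ⟨s, t, ε, 0, hst, hε, Or.inr rfl, by simp [linForm]⟩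
  · rintro ⟨s, t, ε, δ, hst, hε, rfl | rfl, rfl⟩
    · exact ⟨s, t, ε, hst, hε, Or.inl (by simp [linForm])⟩
    · exact ⟨s, t, ε, hst, hε, Or.inr (by simp [linForm])⟩

end Saito

/-- Let `ℓ ≥ 2`.  The derivations `θ_E, φ_1, …, φ_ℓ` form a basis of `D(cS(D_ℓ))`
as an `S`-module: they all belong to `D(cS(D_ℓ))`, and every `θ ∈ D(cS(D_ℓ))` is
uniquely an `S`-linear combination of them (uniqueness for every such `θ` contains
the `S`-linear independence).  Here `θ_E` is the Euler derivation and the `φ_j` are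
the derivations with `φ_j(z) = 0` whose values on the variables are the `φ_j(x_i)`. -/
theorem basis_of_D (B : ℤ → ℕ → Polynomial ℝ) (hB : BProp B)
    (ℓ : ℕ) (hℓ : 2 ≤ ℓ)
    (θE : Derivation ℝ (SS ℓ) (SS ℓ)) (hE : ∀ p : Fin (ℓ + 1), θE (X p) = X p)
    (φ : Fin ℓ → Derivation ℝ (SS ℓ) (SS ℓ))
    (hφz : ∀ j : Fin ℓ, φ j (X (Fin.last ℓ)) = 0)
    (hφx : ∀ j i : Fin ℓ,
      algebraMap (SS ℓ) (KK ℓ) (φ j (X i.castSucc)) = phi B ℓ j i) :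
    ((∀ α ∈ forms ℓ, α ∣ θE α) ∧ ∀ j : Fin ℓ, ∀ α ∈ forms ℓ, α ∣ φ j α) ∧
    ∀ θ : Derivation ℝ (SS ℓ) (SS ℓ), (∀ α ∈ forms ℓ, α ∣ θ α) →
      ∃! c : Fin (ℓ + 1) → SS ℓ,
        θ = c (Fin.last ℓ) • θE + ∑ j : Fin ℓ, c j.castSucc • φ j := by
  have hℓ0 : 0 < ℓ := by omega
  have hz0 : (X (Fin.last ℓ) : SS ℓ) ≠ 0 := X_ne_zero _
  let M : Matrix (Fin ℓ) (Fin ℓ) (SS ℓ) := Matrix.of fun i j => φ j (X i.castSucc)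
  have hM : ∀ i j, algebraMap (SS ℓ) (KK ℓ) (M i j) = phi B ℓ j i := fun i j => hφx j i
  have happ : ∀ (c : Fin (ℓ + 1) → SS ℓ) (p : Fin (ℓ + 1)),
      (c (Fin.last ℓ) • θE + ∑ j : Fin ℓ, c j.castSucc • φ j) (X p)
        = c (Fin.last ℓ) * X p + ∑ j : Fin ℓ, c j.castSucc * φ j (X p) := by
    intro c p
    rw [Derivation.add_apply, Derivation.smul_apply, hE, smul_eq_mul,
      ← Derivation.coeFnAddMonoidHom_apply, map_sum, Finset.sum_apply]
    rfl
  have happz : ∀ c : Fin (ℓ + 1) → SS ℓ,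
      (c (Fin.last ℓ) • θE + ∑ j : Fin ℓ, c j.castSucc • φ j) (X (Fin.last ℓ))
        = c (Fin.last ℓ) * X (Fin.last ℓ) := by
    intro c
    rw [happ]
    simp [hφz]
  have happx : ∀ (c : Fin (ℓ + 1) → SS ℓ) (i : Fin ℓ),
      (c (Fin.last ℓ) • θE + ∑ j : Fin ℓ, c j.castSucc • φ j) (X i.castSucc)
        = c (Fin.last ℓ) * X i.castSucc + M.mulVec (fun j => c j.castSucc) i := by
    intro c i
    rw [happ]
    congr 1
    exact sum_congr rfl fun j _ => mul_comm _ _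
  refine ⟨⟨?_, ?_⟩, ?_⟩
  · intro α hα
    obtain rfl | ⟨s, t, ε, δ, -, -, -, rfl⟩ := (mem_forms_iff α).1 hα
    · rw [hE]
    · rw [derivation_linForm, hE, hE, hE]
      exact dvd_rfl
  · intro j α hα
    obtain rfl | ⟨s, t, ε, δ, hst, hε, hδ, rfl⟩ := (mem_forms_iff α).1 hα
    · rw [hφz]
      exact dvd_zero _
    · rw [derivation_linForm, hφz, mul_zero, sub_zero]
      exact linForm_dvd_phi hB hst hε hδ (hφx j s) (hφx j t)
  · intro θ hθ
    obtain ⟨c0, hc0⟩ := hθ _ ((mem_forms_iff _).2 (Or.inl rfl))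
    obtain ⟨c, hc⟩ := exists_mulVec_eq hB hℓ0 M hM
      (fun i => θ (X i.castSucc) - c0 * X i.castSucc) (by
        intro s t ε δ hst hε hδ
        have h1 := hθ _ ((mem_forms_iff _).2 (Or.inr ⟨s, t, ε, δ, hst, hε, hδ, rfl⟩))
        rw [derivation_linForm, hc0] at h1
        have h2 := dvd_sub h1 (dvd_mul_left (linForm ℓ s t ε δ) c0)
        convert h2 using 1
        rw [linForm]
        ring)
    refine ⟨Fin.snoc c c0, ?_, ?_⟩
    · refine MvPolynomial.derivation_ext fun p => ?_
      induction p using Fin.lastCases with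
      | last => rw [happz, Fin.snoc_last, hc0, mul_comm]
      | cast i =>
        rw [happx]
        simp only [Fin.snoc_last, Fin.snoc_castSucc]
        rw [hc]
        ring
    · intro c' hc'
      have h1 : c' (Fin.last ℓ) = c0 := by
        have := happz c'
        rw [← hc', hc0, mul_comm] at this
        exact (mul_right_cancel₀ hz0 this).symm
      have h2 : M.mulVec ((fun j => c' j.castSucc) - c) = 0 := by
        rw [Matrix.mulVec_sub, hc]
        funext i
        have := happx c' i
        rw [← hc', h1] at this
        simp only [Pi.sub_apply, Pi.zero_apply]
        rw [this]
        ring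
      have h3 := Matrix.eq_zero_of_mulVec_eq_zero (det_ne_zero hB hℓ0 M hM) h2
      funext p
      induction p using Fin.lastCases with
      | last => rw [h1, Fin.snoc_last]
      | cast i =>
        rw [Fin.snoc_castSucc]
        exact sub_eq_zero.1 (congrFun h3 i)

end
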